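/- Let X be a spectral space such that every minimal point of X lies in the patch closure of the set X^max of maximal points. The following are equivalent: (a) X is Boolean (compact, Hausdorff, and zero-dimensional, i.e. the specialization order is trivial); (b) qccl(X) is a Stone algebra; (c) the inverse space X_inv is an Esakia space; (d) X_inv is a PC-space; (e) X^max is patch closed. -/

import Mathlib

open Set Topology

namespace PCF

variable {X : Type*}

/-- The compact open subsets of a topological space. -/
def qcop (t : TopologicalSpace X) : Set (Set X) :=
  {U | @IsOpen X t U ∧ @IsCompact X t U}

/-- The complements of the compact open subsets. -/
def qccl (t : TopologicalSpace X) : Set (Set X) :=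
  {C | ∃ U ∈ qcop t, C = Uᶜ}

/-- The Boolean algebra of subsets generated by the compact open sets:
the constructible sets. -/
def Constructible (t : TopologicalSpace X) : Set (Set X) :=
  ⋂₀ {B : Set (Set X) | qcop t ⊆ B ∧ (∀ s ∈ B, sᶜ ∈ B) ∧
        (∀ s ∈ B, ∀ u ∈ B, s ∪ u ∈ B) ∧ (∅ : Set X) ∈ B}

/-- The patch topology: generated by the compact open sets together with their
complements (equivalently, by the constructible sets). -/
def patchTop (t : TopologicalSpace X) : TopologicalSpace X :=
  TopologicalSpace.generateFrom (qcop t ∪ qccl t)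

/-- The inverse topology, with the complements of compact opens as a basis of opens. -/
def invTop (t : TopologicalSpace X) : TopologicalSpace X :=
  TopologicalSpace.generateFrom (qccl t)

/-- The specialization order: `x ≤ y` iff `y` is in the closure of `{x}`. -/
def specLE (t : TopologicalSpace X) (x y : X) : Prop := y ∈ @closure X t {x}

/-- Minimal points for the specialization order. -/
def minPts (t : TopologicalSpace X) : Set X := {x | ∀ y, specLE t y x → y = x}

/-- Maximal points for the specialization order. -/
def maxPts (t : TopologicalSpace X) : Set X := {x | ∀ y, specLE t x y → y = x}

/-- Minimal points of a subset `S`, for the induced specialization order. -/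
def minPtsIn (t : TopologicalSpace X) (S : Set X) : Set X :=
  {x | x ∈ S ∧ ∀ y ∈ S, specLE t y x → y = x}

/-- Maximal points of a subset `S`, for the induced specialization order. -/
def maxPtsIn (t : TopologicalSpace X) (S : Set X) : Set X :=
  {x | x ∈ S ∧ ∀ y ∈ S, specLE t x y → y = x}

/-- The down-set (set of generalizations) generated by `S`. -/
def downset (t : TopologicalSpace X) (S : Set X) : Set X :=
  {x | ∃ s ∈ S, specLE t x s}

/-- The up-set (set of specializations) generated by `S`. -/
def upset (t : TopologicalSpace X) (S : Set X) : Set X :=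
  {x | ∃ s ∈ S, specLE t s x}

/-- A topology is spectral if the space is compact, sober (quasi-sober and T0),
the compact opens form a basis, and the compact opens are closed under
finite intersections. -/
def IsSpectral (t : TopologicalSpace X) : Prop :=
  @CompactSpace X t ∧ @QuasiSober X t ∧ @T0Space X t ∧
  @TopologicalSpace.IsTopologicalBasis X t (qcop t) ∧
  ∀ U ∈ qcop t, ∀ V ∈ qcop t, U ∩ V ∈ qcop t

/-- A Boolean space: compact, Hausdorff and zero-dimensional. -/
def IsBooleanSpace (t : TopologicalSpace X) : Prop :=
  @CompactSpace X t ∧ @T2Space X t ∧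
  @TopologicalSpace.IsTopologicalBasis X t {U | @IsClopen X t U}

/-- `V` is the pseudocomplement of `U` in the lattice of sets `L` (ordered by
inclusion, with meet given by intersection and bottom element `∅`): `V` is the
largest element of `L` disjoint from `U`. -/
def IsPseudoCompl (L : Set (Set X)) (U V : Set X) : Prop :=
  V ∈ L ∧ U ∩ V = ∅ ∧ ∀ W ∈ L, U ∩ W = ∅ → W ⊆ V

/-- The lattice of sets `L` is pseudocomplemented: every element has a
pseudocomplement. -/
def Pseudocomplemented (L : Set (Set X)) : Prop :=
  ∀ U ∈ L, ∃ V, IsPseudoCompl L U V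

/-- The lattice of sets `L` is a Stone algebra: it is pseudocomplemented and
`U* ∪ U** = ⊤` for every `U`. -/
def StoneAlgebra (L : Set (Set X)) : Prop :=
  Pseudocomplemented L ∧
  ∀ U ∈ L, ∀ V W : Set X, IsPseudoCompl L U V → IsPseudoCompl L V W → V ∪ W = univ

/-- The lattice of sets `L` is a Heyting algebra: for all `U, V ∈ L` there is a
largest `W ∈ L` with `U ∩ W ⊆ V`. -/
def HeytingAlg (L : Set (Set X)) : Prop :=
  ∀ U ∈ L, ∀ V ∈ L, ∃ W ∈ L, U ∩ W ⊆ V ∧ ∀ W' ∈ L, U ∩ W' ⊆ V → W' ⊆ W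

/-- A PC-space: the lattice of compact open sets is pseudocomplemented. -/
def IsPCSpace (t : TopologicalSpace X) : Prop := Pseudocomplemented (qcop t)

/-- An Esakia space: the closure of every constructible set is constructible. -/
def IsEsakia (t : TopologicalSpace X) : Prop :=
  ∀ S ∈ Constructible t, @closure X t S ∈ Constructible t

/-- A spectral root system: the closure of every point is a specialization chain. -/
def IsRootSystem (t : TopologicalSpace X) : Prop :=
  ∀ x : X, IsChain (specLE t) (@closure X t {x})

/-- A spectral forest: the inverse space is a spectral root system. -/
def IsForest (t : TopologicalSpace X) : Prop := IsRootSystem (invTop t)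

/-- A stranded space: the specialization poset is a disjoint union of chains, i.e.
the set of points comparable with any fixed point is a chain. -/
def Stranded (t : TopologicalSpace X) : Prop :=
  ∀ x : X, IsChain (specLE t) {y | specLE t x y ∨ specLE t y x}

end PCF

open PCF

section Rings

variable (T : Type*) [TopologicalSpace T]

/-- The zero set of a continuous real-valued function. -/
def zeroSet (f : ContinuousMap T ℝ) : Set T := {t | f t = 0}

/-- The lattice of cozero sets of a topological space. -/
def Coz : Set (Set T) := {U | ∃ f : ContinuousMap T ℝ, U = {t | f t ≠ 0}}

/-- A z-ideal of the ring `C(T)` of continuous real-valued functions. -/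
def IsZIdeal (I : Ideal (ContinuousMap T ℝ)) : Prop :=
  ∀ f ∈ I, ∀ g : ContinuousMap T ℝ, zeroSet T f ⊆ zeroSet T g → g ∈ I

/-- The prime z-ideals, as a subset of the prime spectrum of `C(T)`. -/
def zSpec : Set (PrimeSpectrum (ContinuousMap T ℝ)) :=
  {p | IsZIdeal T p.asIdeal}

/-- A space is basically disconnected if the closure of every cozero set is open. -/
def BasicallyDisconnected : Prop :=
  ∀ f : ContinuousMap T ℝ, IsOpen (closure {t | f t ≠ 0})

/-- The Zariski topology on the prime spectrum of `C(T)`. -/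
def specTop : TopologicalSpace (PrimeSpectrum (ContinuousMap T ℝ)) := inferInstance

/-- The subspace topology on the set of prime z-ideals. -/
def zTop : TopologicalSpace ↥(zSpec T) := inferInstance

end Rings

/-- The subspace topology on a subset. -/
def subTop {Y : Type*} [TopologicalSpace Y] (X : Set Y) : TopologicalSpace ↥X :=
  inferInstance

namespace PCF

variable {X : Type*}

theorem IsSpectral.spectralSpace [t : TopologicalSpace X] (hX : IsSpectral t) :
    SpectralSpace X := by
  obtain ⟨hc, hs, h0, hb, hi⟩ := hX
  have : PrespectralSpace X := ⟨hb⟩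
  have : QuasiSeparatedSpace X :=
    ⟨fun U V hU hU' hV hV' => (hi U ⟨hU, hU'⟩ V ⟨hV, hV'⟩).2⟩
  constructor

theorem IsSpectral.univ_mem_qcop [t : TopologicalSpace X] (hX : IsSpectral t) :
    univ ∈ qcop t :=
  have := hX.1
  ⟨isOpen_univ, isCompact_univ⟩

theorem patchTop_eq_constructibleTopology [t : TopologicalSpace X] :
    patchTop t = constructibleTopology X := by
  unfold patchTop constructibleTopology
  congr 1
  ext s
  simp only [qcop, qccl, constructibleTopologySubbasis, mem_union, mem_ofPred_eq]
  refine or_congr Iff.rfl ⟨?_, fun h => ⟨sᶜ, ⟨h.1.isOpen_compl, h.2⟩, (compl_compl s).symm⟩⟩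
  rintro ⟨U, hU, rfl⟩
  exact ⟨hU.1.isClosed_compl, by simpa using hU.2⟩

theorem IsSpectral.compactSpace_patchTop [t : TopologicalSpace X] (hX : IsSpectral t) :
    @CompactSpace X (patchTop t) := by
  have := hX.spectralSpace
  rw [patchTop_eq_constructibleTopology]
  exact @Function.Surjective.compactSpace (WithConstructibleTopology X) X _
    (constructibleTopology X) WithTopology.ofTopology (WithTopology.continuous_ofTopology _)
    inferInstance (WithTopology.ofTopology_surjective _)

theorem patchTop_le_invTop (t : TopologicalSpace X) : patchTop t ≤ invTop t :=
  TopologicalSpace.generateFrom_anti subset_union_right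

theorem isOpen_patchTop_of_mem_qcop {t : TopologicalSpace X} {U : Set X} (hU : U ∈ qcop t) :
    IsOpen[patchTop t] U :=
  TopologicalSpace.isOpen_generateFrom_of_mem (Or.inl hU)

theorem isClosed_patchTop_of_mem_qcop {t : TopologicalSpace X} {U : Set X} (hU : U ∈ qcop t) :
    IsClosed[patchTop t] U :=
  @IsClosed.mk _ (patchTop t) _ (TopologicalSpace.isOpen_generateFrom_of_mem (Or.inr ⟨U, hU, rfl⟩))

theorem union_mem_qcop {t : TopologicalSpace X} {U V : Set X} (hU : U ∈ qcop t)
    (hV : V ∈ qcop t) : U ∪ V ∈ qcop t :=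
  ⟨hU.1.union hV.1, hU.2.union hV.2⟩

theorem isTopologicalBasis_invTop (t : TopologicalSpace X) :
    @TopologicalSpace.IsTopologicalBasis X (invTop t) (qccl t) := by
  refine @TopologicalSpace.isTopologicalBasis_of_subbasis_of_finiteInter X (invTop t) _ rfl ⟨?_, ?_⟩
  · exact ⟨∅, ⟨isOpen_empty, isCompact_empty⟩, compl_empty.symm⟩
  · rintro _ ⟨U, hU, rfl⟩ _ ⟨V, hV, rfl⟩
    exact ⟨U ∪ V, union_mem_qcop hU hV, (compl_union U V).symm⟩

/-- Inverse-open patch-closed subsets are compact open in the inverse topology. -/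
theorem IsSpectral.mem_qcop_invTop [t : TopologicalSpace X] (hX : IsSpectral t) {S : Set X}
    (ho : IsOpen[invTop t] S) (hc : IsClosed[patchTop t] S) : S ∈ qcop (invTop t) := by
  refine ⟨ho, ?_⟩
  have hS := @IsClosed.isCompact X (patchTop t) S hX.compactSpace_patchTop hc
  simpa using @IsCompact.image X X (patchTop t) (invTop t) S id hS
    (continuous_id_iff_le.2 (patchTop_le_invTop t))

/-- The compact open subsets of the inverse space are the complements of the compact open sets. -/
theorem IsSpectral.qcop_invTop [t : TopologicalSpace X] (hX : IsSpectral t) :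
    qcop (invTop t) = qccl t := by
  ext S
  constructor
  · rintro ⟨ho, hc⟩
    obtain ⟨F, hF, rfl⟩ : ∃ F : Set (Set X), F ⊆ qccl t ∧ S = ⋃₀ F :=
      @TopologicalSpace.IsTopologicalBasis.open_eq_sUnion X (invTop t) _
        (isTopologicalBasis_invTop t) _ ho
    obtain ⟨G, hGF, hG, hsub⟩ := @IsCompact.elim_finite_subcover_image X _ (invTop t) _ F id hc
      (fun s hs => TopologicalSpace.isOpen_generateFrom_of_mem (hF hs)) sUnion_eq_biUnion.subset
    have hS : ⋃₀ F = ⋃₀ G := (hsub.trans sUnion_eq_biUnion.superset).antisymm (sUnion_mono hGF)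
    rw [hS]
    have hG' : G ⊆ qccl t := hGF.trans hF
    clear hS hsub hGF hc ho
    induction G, hG using Set.Finite.induction_on with
    | empty => exact ⟨univ, hX.univ_mem_qcop, by simp⟩
    | @insert A G _ _ ih =>
      obtain ⟨U, hU, rfl⟩ := hG' (mem_insert _ _)
      obtain ⟨V, hV, h⟩ := ih ((subset_insert _ _).trans hG')
      rw [sUnion_insert, h, ← compl_inter]
      exact ⟨U ∩ V, hX.2.2.2.2 U hU V hV, rfl⟩
  · rintro ⟨U, hU, rfl⟩
    exact hX.mem_qcop_invTop
      (TopologicalSpace.isOpen_generateFrom_of_mem ⟨U, hU, rfl⟩)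
      (@IsOpen.isClosed_compl X (patchTop t) _ (isOpen_patchTop_of_mem_qcop hU))

theorem isClopen_of_mem_constructible {s t : TopologicalSpace X}
    (h : ∀ U ∈ qcop s, @IsClopen X t U) {S : Set X} (hS : S ∈ Constructible s) : @IsClopen X t S :=
  hS {A | @IsClopen X t A} ⟨h, fun _ => IsClopen.compl, fun _ hA _ hB => IsClopen.union hA hB,
    isClopen_empty⟩

theorem mem_constructible_of_mem_qcop {t : TopologicalSpace X} {U : Set X} (hU : U ∈ qcop t) :
    U ∈ Constructible t :=
  fun _ hB => hB.1 hU

theorem IsSpectral.isClopen_patchTop_of_mem_qcop_invTop [t : TopologicalSpace X]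
    (hX : IsSpectral t) {U : Set X} (hU : U ∈ qcop (invTop t)) : @IsClopen X (patchTop t) U := by
  rw [hX.qcop_invTop] at hU
  obtain ⟨V, hV, rfl⟩ := hU
  exact @IsClopen.compl X (patchTop t) _
    ⟨isClosed_patchTop_of_mem_qcop hV, isOpen_patchTop_of_mem_qcop hV⟩

theorem IsSpectral.isPCSpace_invTop_of_isEsakia [t : TopologicalSpace X] (hX : IsSpectral t)
    (h : IsEsakia (invTop t)) : IsPCSpace (invTop t) := by
  intro U hU
  have hcl := isClopen_of_mem_constructible (t := patchTop t)
    (fun _ => hX.isClopen_patchTop_of_mem_qcop_invTop)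
    (h U (mem_constructible_of_mem_qcop hU))
  refine ⟨(@closure X (invTop t) U)ᶜ, ?_, ?_, ?_⟩
  · exact hX.mem_qcop_invTop (@IsClosed.isOpen_compl X (invTop t) _ (@isClosed_closure X (invTop t) _))
      (@IsClopen.compl X (patchTop t) _ hcl).1
  · exact disjoint_iff_inter_eq_empty.1
      (disjoint_compl_right_iff_subset.2 (@subset_closure X (invTop t) U))
  · intro W hW hUW
    exact (@Disjoint.closure_left X (invTop t) _ _ (disjoint_iff_inter_eq_empty.2 hUW)
      hW.1).subset_compl_left

theorem maxPts_isClosed_singleton [t : TopologicalSpace X] {m : X} (hm : m ∈ maxPts t) :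
    IsClosed {m} :=
  isClosed_of_closure_subset fun y hy => hm y hy

/-- A closed point outside a compact set can be separated from it by the complement of a
compact open set. -/
theorem exists_mem_qcop_of_notMem [t : TopologicalSpace X]
    (hb : TopologicalSpace.IsTopologicalBasis (qcop t)) {C : Set X} (hC : IsCompact C) {m : X}
    (hm : IsClosed {m}) (hmC : m ∉ C) : ∃ U ∈ qcop t, C ⊆ U ∧ m ∉ U := by
  refine hC.induction_on (p := fun C => ∃ U ∈ qcop t, C ⊆ U ∧ m ∉ U) ?_ ?_ ?_ ?_
  · exact ⟨∅, ⟨isOpen_empty, isCompact_empty⟩, subset_rfl, notMem_empty m⟩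
  · rintro s u hsu ⟨U, hU, hUu, hmU⟩
    exact ⟨U, hU, hsu.trans hUu, hmU⟩
  · rintro s u ⟨U, hU, hsU, hmU⟩ ⟨V, hV, huV, hmV⟩
    exact ⟨U ∪ V, union_mem_qcop hU hV, union_subset_union hsU huV, by simp [hmU, hmV]⟩
  · intro c hc
    have hcm : c ∈ ({m} : Set X)ᶜ := fun h => hmC (mem_singleton_iff.1 h ▸ hc)
    obtain ⟨U, hU, hcU, hUm⟩ := hb.exists_subset_of_mem_open hcm hm.isOpen_compl
    exact ⟨U, mem_nhdsWithin_of_mem_nhds (hU.1.mem_nhds hcU), U, hU, subset_rfl,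
      fun h => hUm h rfl⟩

theorem IsSpectral.isClosed_maxPts_of_isPCSpace [t : TopologicalSpace X] (hX : IsSpectral t)
    (h : IsPCSpace (invTop t)) : IsClosed[patchTop t] (maxPts t) := by
  have := hX.1
  have := hX.2.2.1
  have hb := hX.2.2.2.1
  rw [IsPCSpace, hX.qcop_invTop] at h
  refine @isClosed_of_closure_subset X (patchTop t) _ fun x hx y hxy => ?_
  by_contra hne
  obtain ⟨U, hU, hxU, hyU⟩ : ∃ U ∈ qcop t, x ∈ U ∧ y ∉ U := by
    by_contra! hcon
    refine hne (Inseparable.eq (inseparable_iff_specializes_and.2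
      ⟨?_, specializes_iff_mem_closure.2 hxy⟩))
    exact (hb.nhds_hasBasis.specializes_iff).2 fun V hV => hcon V hV.1 hV.2
  obtain ⟨_, ⟨W, hW, rfl⟩, hdis, hmax⟩ := h Uᶜ ⟨U, hU, rfl⟩
  have hxW : x ∈ W := by
    by_contra hxW
    have hy : y ∈ Wᶜ := hW.1.isClosed_compl.closure_subset_iff.2 (singleton_subset_iff.2 hxW) hxy
    exact (hdis.subset ⟨hyU, hy⟩ : y ∈ (∅ : Set X))
  obtain ⟨m, ⟨hmW, hmU⟩, hm⟩ := (@mem_closure_iff X (patchTop t) _ _).1 hx (W ∩ U)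
    (@IsOpen.inter X (patchTop t) _ _ (isOpen_patchTop_of_mem_qcop hW)
      (isOpen_patchTop_of_mem_qcop hU)) ⟨hxW, hxU⟩
  obtain ⟨V, hV, hUV, hmV⟩ := exists_mem_qcop_of_notMem hb hU.1.isClosed_compl.isCompact
    (maxPts_isClosed_singleton hm) (fun h => h hmU)
  exact hmax Vᶜ ⟨V, hV, rfl⟩
    (disjoint_iff_inter_eq_empty.1 (disjoint_compl_right_iff_subset.2 hUV)) hmV hmW

theorem exists_mem_minPts_specLE [t : TopologicalSpace X] [QuasiSober X] [T0Space X] (z : X) :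
    ∃ x ∈ minPts t, specLE t x z := by
  obtain ⟨x, hx⟩ := QuasiSober.sober (isIrreducible_irreducibleComponent (x := z))
    isClosed_irreducibleComponent
  refine ⟨x, fun y hy => ?_, ?_⟩
  swap
  · rw [specLE, hx.def]
    exact mem_irreducibleComponent
  have hyx : y ⤳ x := specializes_iff_mem_closure.2 hy
  have hc := eq_irreducibleComponent (x := z) (isIrreducible_singleton (x := y)).closure.2
    (hx.def ▸ hyx.closure_subset)
  exact IsGenericPoint.eq (S := irreducibleComponent z) hc hx

/-- If all points are maximal for the specialization order, patch closed sets are closed. -/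
theorem IsSpectral.isClosed_of_isClosed_patchTop [t : TopologicalSpace X] (hX : IsSpectral t)
    (hmax : ∀ x, x ∈ maxPts t) {S : Set X} (hS : IsClosed[patchTop t] S) : IsClosed S := by
  have hc := @IsClosed.isCompact X (patchTop t) S hX.compactSpace_patchTop hS
  refine isClosed_of_closure_subset fun z hz => ?_
  by_contra hzS
  obtain ⟨V, hV, hzV, hVS⟩ : ∃ V, IsOpen V ∧ z ∈ V ∧ Disjoint V S := by
    refine @IsCompact.induction_on X (patchTop t) S hc (fun T => ∃ V, IsOpen V ∧ z ∈ V ∧ Disjoint V T)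
      ?_ ?_ ?_ ?_
    · exact ⟨univ, isOpen_univ, mem_univ z, disjoint_empty _⟩
    · rintro s u hsu ⟨V, hV, hz, hd⟩
      exact ⟨V, hV, hz, hd.mono_right hsu⟩
    · rintro s u ⟨V, hV, hz, hd⟩ ⟨W, hW, hzW, hdW⟩
      exact ⟨V ∩ W, hV.inter hW, ⟨hz, hzW⟩,
        disjoint_union_right.2 ⟨hd.mono_left inter_subset_left, hdW.mono_left inter_subset_right⟩⟩
    · intro s hs
      have hzs : z ∈ ({s} : Set X)ᶜ := fun h => hzS (mem_singleton_iff.1 h ▸ hs)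
      obtain ⟨V, hV, hzV, hVs⟩ := hX.2.2.2.1.exists_subset_of_mem_open hzs
        (maxPts_isClosed_singleton (hmax s)).isOpen_compl
      refine ⟨Vᶜ, @mem_nhdsWithin_of_mem_nhds X (patchTop t) _ _ _ ?_, V, hV.1, hzV,
        disjoint_compl_right⟩
      exact @IsOpen.mem_nhds X (patchTop t) _ _
        (@IsClosed.isOpen_compl X (patchTop t) _ (isClosed_patchTop_of_mem_qcop hV))
        (fun h => hVs h rfl)
  obtain ⟨w, hwV, hwS⟩ := mem_closure_iff.1 hz V hV hzV
  exact hVS.le_bot ⟨hwV, hwS⟩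

theorem IsSpectral.isBooleanSpace_of_forall_mem_maxPts [t : TopologicalSpace X]
    (hX : IsSpectral t) (hmax : ∀ x, x ∈ maxPts t) : IsBooleanSpace t := by
  have hb := hX.2.2.2.1
  have hclosed : ∀ U ∈ qcop t, IsClosed U := fun U hU =>
    hX.isClosed_of_isClosed_patchTop hmax (isClosed_patchTop_of_mem_qcop hU)
  refine ⟨hX.1, ⟨fun x y hxy => ?_⟩,
    hb.of_isOpen_of_subset (fun _ hs => hs.2) fun U hU => ⟨hclosed U hU, hU.1⟩⟩
  obtain ⟨U, hU, hxU, hUy⟩ := hb.exists_subset_of_mem_open (a := x) (u := {y}ᶜ) hxy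
    (maxPts_isClosed_singleton (hmax y)).isOpen_compl
  exact ⟨U, Uᶜ, hU.1, (hclosed U hU).isOpen_compl, hxU, fun h => hUy h rfl, disjoint_compl_right⟩

theorem IsBooleanSpace.isClopen [t : TopologicalSpace X] (h : IsBooleanSpace t) {U : Set X}
    (hU : U ∈ qcop t) : IsClopen U :=
  have := h.2.1
  ⟨hU.2.isClosed, hU.1⟩

theorem IsBooleanSpace.compl_mem_qcop [t : TopologicalSpace X] (h : IsBooleanSpace t) {U : Set X}
    (hU : U ∈ qcop t) : Uᶜ ∈ qcop t :=
  have := h.1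
  ⟨(h.isClopen hU).1.isOpen_compl, (h.isClopen hU).compl.1.isCompact⟩

theorem IsBooleanSpace.qccl_eq [t : TopologicalSpace X] (h : IsBooleanSpace t) :
    qccl t = qcop t := by
  ext S
  constructor
  · rintro ⟨U, hU, rfl⟩
    exact h.compl_mem_qcop hU
  · exact fun hS => ⟨Sᶜ, h.compl_mem_qcop hS, (compl_compl S).symm⟩

theorem IsPseudoCompl.eq_compl {L : Set (Set X)} {U V : Set X} (h : IsPseudoCompl L U V)
    (hU : Uᶜ ∈ L) : V = Uᶜ :=
  (disjoint_iff_inter_eq_empty.2 h.2.1).subset_compl_left.antisymm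
    (h.2.2 _ hU (inter_compl_self U))

theorem stoneAlgebra_of_compl_mem {L : Set (Set X)} (h : ∀ U ∈ L, Uᶜ ∈ L) : StoneAlgebra L := by
  refine ⟨fun U hU => ⟨Uᶜ, h U hU, inter_compl_self U, fun W _ hW =>
    (disjoint_iff_inter_eq_empty.2 hW).subset_compl_left⟩, fun U hU V W hV hW => ?_⟩
  rw [hW.eq_compl (h V hV.1), union_compl_self]

theorem IsBooleanSpace.isEsakia_invTop [t : TopologicalSpace X] (h : IsBooleanSpace t)
    (hX : IsSpectral t) : IsEsakia (invTop t) := by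
  have ht : invTop t = t := by
    rw [invTop, h.qccl_eq, ← hX.2.2.2.1.eq_generateFrom]
  rw [ht]
  intro S hS
  have hS' := isClopen_of_mem_constructible (fun _ => h.isClopen) hS
  rwa [hS'.1.closure_eq]

end PCF

/-- For a spectral space `X` in which every minimal point lies in the patch
closure of `X^max`, TFAE: (a) `X` is Boolean; (b) `qccl X` is a Stone algebra; (c) the
inverse space of `X` is an Esakia space; (d) the inverse space of `X` is a PC-space;
(e) `X^max` is patch closed. -/
theorem statement_7 {X : Type*} [t : TopologicalSpace X] (hX : IsSpectral t)
    (hmin : minPts t ⊆ @closure X (patchTop t) (maxPts t)) :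
    List.TFAE
      [ IsBooleanSpace t,
        StoneAlgebra (qccl t),
        IsEsakia (invTop t),
        IsPCSpace (invTop t),
        IsClosed[patchTop t] (maxPts t) ] := by
  tfae_have 1 → 2 := fun h => by
    rw [h.qccl_eq]
    exact stoneAlgebra_of_compl_mem fun _ => h.compl_mem_qcop
  tfae_have 1 → 3 := fun h => h.isEsakia_invTop hX
  tfae_have 2 → 4 := fun h => by
    rw [IsPCSpace, hX.qcop_invTop]
    exact h.1
  tfae_have 3 → 4 := hX.isPCSpace_invTop_of_isEsakia
  tfae_have 4 → 5 := hX.isClosed_maxPts_of_isPCSpace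
  tfae_have 5 → 1 := fun h => by
    have := hX.2.1
    have := hX.2.2.1
    rw [@IsClosed.closure_eq X (patchTop t) _ h] at hmin
    refine hX.isBooleanSpace_of_forall_mem_maxPts fun z => ?_
    obtain ⟨x, hx, hxz⟩ := exists_mem_minPts_specLE z
    rw [hmin hx z hxz]
    exact hmin hx
  tfae_finish
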